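/- Assume f defines a quasihomogeneous isolated singularity. Extend ∂̄_f and ∂ z-coefficientwise to PV[z] and set D := ∂̄_f + z·∂. Then the complex (PV[z], D) is exact in positive exterior degrees: for every p ≥ 1, ker(D : PV^p[z] → PV^{p−1}[z]) = range(D : PV^{p+1}[z] → PV^p[z]). -/

import Mathlib

open MvPolynomial TensorProduct

noncomputable section

/-- The Jacobian ideal of `f`. -/
def jacobianIdeal {N : ℕ} (f : MvPolynomial (Fin N) ℂ) :
    Ideal (MvPolynomial (Fin N) ℂ) :=
  Ideal.span (Set.range fun k : Fin N => pderiv k f)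

/-- `R[z]`, realized as polynomials in `x₁,…,x_N` with coefficients in `ℂ[z]`. -/
abbrev Rz (N : ℕ) := MvPolynomial (Fin N) (Polynomial ℂ)

/-- The inclusion `R → R[z]`. -/
def toRz {N : ℕ} (p : MvPolynomial (Fin N) ℂ) : Rz N :=
  MvPolynomial.map (Polynomial.C : ℂ →+* Polynomial ℂ) p

/-- The exterior algebra `⋀(ℂ^N)` on the generators `θ₁,…,θ_N`. -/
abbrev ExtN (N : ℕ) := ExteriorAlgebra ℂ (Fin N → ℂ)

/-- `PV[z] = R[z] ⊗ ⋀(ℂ^N)`, the `z`-extension of polynomial polyvector fields. -/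
abbrev PVz (N : ℕ) := Rz N ⊗[ℂ] ExtN N

/-- Contraction (interior product) with the `k`-th dual covector. -/
def contr {N : ℕ} (k : Fin N) : ExtN N →ₗ[ℂ] ExtN N :=
  CliffordAlgebra.contractLeft (LinearMap.proj k)

/-- The twisted differential `D = ∂̄_f + z∂` on `PV[z]`, acting by
`α ⊗ ω ↦ Σ_k ((∂f/∂x_k)·α + z·∂α/∂x_k) ⊗ ι_k(ω)`. -/
def Dop {N : ℕ} (f : MvPolynomial (Fin N) ℂ) : PVz N →ₗ[ℂ] PVz N :=
  ∑ k : Fin N, TensorProduct.map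
    (LinearMap.mulLeft ℂ (toRz (pderiv k f)) +
      LinearMap.mulLeft ℂ (MvPolynomial.C Polynomial.X) ∘ₗ
        LinearMap.restrictScalars ℂ (pderiv k).toLinearMap)
    (contr k)

/-- The `p`-th exterior power, as a submodule of the exterior algebra. -/
def grE (N p : ℕ) : Submodule ℂ (ExtN N) :=
  (LinearMap.range (ExteriorAlgebra.ι ℂ : (Fin N → ℂ) →ₗ[ℂ] ExtN N)) ^ p

/-- The graded piece `PV^p[z] = R[z] ⊗ ⋀^p(ℂ^N)` of `PV[z]`. -/
def PVzgr (N p : ℕ) : Submodule ℂ (PVz N) :=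
  LinearMap.range (TensorProduct.map (LinearMap.id : Rz N →ₗ[ℂ] Rz N) (grE N p).subtype)


namespace TwistedAux
open Module

variable {N : ℕ}

def B (N : ℕ) : Basis (Finset (Fin N)) ℂ (ExtN N) := (Pi.basisFun ℂ (Fin N)).ExteriorAlgebra

def th (i : Fin N) : ExtN N := ExteriorAlgebra.ι ℂ (Pi.single i (1 : ℂ))

def co (J : Finset (Fin N)) : PVz N →ₗ[ℂ] Rz N :=
  (TensorProduct.rid ℂ (Rz N)).toLinearMap ∘ₗ TensorProduct.map LinearMap.id ((B N).coord J)

@[simp] lemma co_tmul (J : Finset (Fin N)) (r : Rz N) (e : ExtN N) :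
    co J (r ⊗ₜ e) = (B N).coord J e • r := by
  simp [co]

lemma expand (x : PVz N) : x = ∑ J, co J x ⊗ₜ[ℂ] B N J := by
  induction x using TensorProduct.induction_on with
  | zero => simp
  | add x y hx hy =>
    conv_lhs => rw [hx, hy]
    simp only [map_add, TensorProduct.add_tmul, Finset.sum_add_distrib]
  | tmul r e =>
    simp only [co_tmul, TensorProduct.smul_tmul, ← TensorProduct.tmul_sum]
    congr 1
    simp

lemma co_ext {x y : PVz N} (h : ∀ J, co J x = co J y) : x = y := by
  rw [expand x, expand y]; simp [h]

lemma co_map (u : Rz N →ₗ[ℂ] Rz N) (L : ExtN N →ₗ[ℂ] ExtN N) (J : Finset (Fin N)) (x : PVz N) :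
    co J (TensorProduct.map u L x) = ∑ I, (B N).coord J (L (B N I)) • u (co I x) := by
  conv_lhs => rw [expand x]
  simp

lemma co_smul (r : Rz N) (x : PVz N) (J : Finset (Fin N)) : co J (r • x) = r * co J x := by
  induction x using TensorProduct.induction_on with
  | zero => simp
  | add x y hx hy => rw [smul_add, map_add, map_add, hx, hy, mul_add]
  | tmul r' e => simp [TensorProduct.smul_tmul']

lemma co_sum_tmul (c : Finset (Fin N) → Rz N) (J : Finset (Fin N)) :
    co J (∑ I, c I ⊗ₜ[ℂ] B N I) = c J := by
  classical
  simp [Finsupp.single_apply]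

lemma B_mem (J : Finset (Fin N)) : B N J ∈ grE N J.card := by
  have := ExteriorAlgebra.basis_eq_coe_basis (Pi.basisFun ℂ (Fin N)) (Set.powersetCard.ofCard (rfl : J.card = J.card))
  have h2 : B N J = _ := this
  rw [h2]
  exact ((Module.Basis.exteriorPower J.card (Pi.basisFun ℂ (Fin N))) _).2

lemma coord_gr {p : ℕ} {e : ExtN N} (he : e ∈ grE N p) {J : Finset (Fin N)} (hJ : J.card ≠ p) :
    (B N).coord J e = 0 := by
  classical
  have he' : e ∈ ⋀[ℂ]^p (Fin N → ℂ) := he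
  have := ((Pi.basisFun ℂ (Fin N)).exteriorPower p).sum_repr ⟨e, he'⟩
  have h2 := congrArg Subtype.val this
  simp only [AddSubmonoidClass.coe_finsetSum, Submodule.coe_smul,
    ← ExteriorAlgebra.basis_eq_coe_basis] at h2
  rw [← h2, map_sum]
  refine Finset.sum_eq_zero fun s _ => ?_
  rw [map_smul]
  have : (B N).coord J ((B N) s.1) = 0 := by
    simp only [Basis.coord_apply, Basis.repr_self]
    apply Finsupp.single_eq_of_ne
    rintro rfl
    exact hJ s.2
  erw [this]; simp

lemma mem_gr {p : ℕ} {x : PVz N} : x ∈ PVzgr N p ↔ ∀ J : Finset (Fin N), J.card ≠ p → co J x = 0 := by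
  constructor
  · rintro ⟨y, rfl⟩ J hJ
    induction y using TensorProduct.induction_on with
    | zero => simp
    | add x y hx hy => simp [hx, hy]
    | tmul r e =>
      rw [TensorProduct.map_tmul, co_tmul, Submodule.subtype_apply, coord_gr e.2 hJ, zero_smul]
  · intro h
    rw [expand x]
    refine Submodule.sum_mem _ fun J _ => ?_
    by_cases hJ : J.card = p
    · subst hJ
      exact ⟨co J x ⊗ₜ ⟨B N J, B_mem J⟩, by simp⟩
    · rw [h J hJ]; simp

lemma B_singleton (i : Fin N) : B N {i} = th i := by
  rw [B, ExteriorAlgebra.basis_apply_ofCard (n := 1) _ (Finset.card_singleton i)]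
  simp [ExteriorAlgebra.ιMulti_family, ExteriorAlgebra.ιMulti_apply, th,
    Set.powersetCard.ofFinEmbEquiv_symm_apply]

lemma B_insert {i : Fin N} {J : Finset (Fin N)} (h : i ∉ J) :
    ∃ c : ℂ, B N (insert i J) = c • (th i * B N J) := by
  classical
  have hd : Disjoint (Set.powersetCard.ofCard (Finset.card_singleton i)).val
     (Set.powersetCard.ofCard (rfl : J.card = J.card)).val := by simpa using h
  have := ExteriorAlgebra.basis_mul_of_disjoint (Pi.basisFun ℂ (Fin N)) _ _ hd
  have h3 : (Set.powersetCard.disjUnion hd).val = insert i J := by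
    ext a; simp [Set.powersetCard.disjUnion]
  rw [h3] at this
  have h4 : th i * B N J = (Set.powersetCard.permOfDisjoint hd).sign • B N (insert i J) := by
    rw [← B_singleton]; exact this
  rw [h4]
  refine ⟨((Set.powersetCard.permOfDisjoint hd).sign : ℤ), ?_⟩
  rcases Int.units_eq_one_or (Set.powersetCard.permOfDisjoint hd).sign with h | h <;> rw [h] <;> simp

lemma contr_th (k i : Fin N) (x : ExtN N) :
    contr k (th i * x) = (if k = i then (1:ℂ) else 0) • x - th i * contr k x := by
  have := CliffordAlgebra.contractLeft_ι_mul (Q := (0 : QuadraticForm ℂ (Fin N → ℂ)))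
    (LinearMap.proj k : (Fin N → ℂ) →ₗ[ℂ] ℂ) (Pi.single i 1) x
  have h2 : contr k (th i * x) = (Pi.single i 1 : Fin N → ℂ) k • x - th i * contr k x := this
  rw [h2, Pi.single_apply]

lemma contr_B_notMem (k : Fin N) (J : Finset (Fin N)) : k ∉ J → contr k (B N J) = 0 := by
  classical
  induction J using Finset.induction_on with
  | empty =>
    intro _
    have h := ExteriorAlgebra.basis_apply_ofCard (n := 0) (Pi.basisFun ℂ (Fin N)) (Finset.card_empty)
    have h1 : B N ∅ = 1 := by
      rw [B, h]; simp [ExteriorAlgebra.ιMulti_family]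
    rw [h1]
    exact CliffordAlgebra.contractLeft_one (Q := (0 : QuadraticForm ℂ (Fin N → ℂ))) _
  | insert i J hi ih =>
    intro hk
    obtain ⟨c, hc⟩ := B_insert hi
    simp only [Finset.mem_insert, not_or] at hk
    rw [hc, map_smul, contr_th, ih hk.2, if_neg hk.1]
    simp

lemma contr_coord {k : Fin N} {I J : Finset (Fin N)} (h : (B N).coord J (contr k (B N I)) ≠ 0) :
    k ∉ J ∧ I = insert k J := by
  classical
  by_cases hk : k ∈ I
  · obtain ⟨c, hc⟩ := B_insert (Finset.notMem_erase k I)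
    rw [Finset.insert_erase hk] at hc
    rw [hc, map_smul, contr_th, contr_B_notMem _ _ (Finset.notMem_erase k I)] at h
    simp [Finsupp.single_apply] at h
    obtain ⟨rfl, _⟩ := h
    simp [Finset.insert_erase hk]
  · rw [contr_B_notMem k I hk] at h
    simp at h

def T (u : Fin N → Rz N →ₗ[ℂ] Rz N) : PVz N →ₗ[ℂ] PVz N :=
  ∑ k : Fin N, TensorProduct.map (u k) (contr k)

lemma T_tmul (u : Fin N → Rz N →ₗ[ℂ] Rz N) (r : Rz N) (e : ExtN N) :
    T u (r ⊗ₜ e) = ∑ k, u k r ⊗ₜ contr k e := by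
  simp [T]

lemma co_T (u : Fin N → Rz N →ₗ[ℂ] Rz N) (J : Finset (Fin N)) (x : PVz N) :
    co J (T u x) = ∑ k, ∑ I, (B N).coord J (contr k (B N I)) • u k (co I x) := by
  simp only [T, LinearMap.sum_apply, map_sum, co_map]

lemma T_add (u v : Fin N → Rz N →ₗ[ℂ] Rz N) (x : PVz N) :
    T (fun k => u k + v k) x = T u x + T v x := by
  simp [T, TensorProduct.map_add_left, Finset.sum_add_distrib]

lemma T_gr (u : Fin N → Rz N →ₗ[ℂ] Rz N) {p : ℕ} {x : PVz N} (hx : x ∈ PVzgr N (p+1)) :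
    T u x ∈ PVzgr N p := by
  rw [mem_gr] at *
  intro J hJ
  rw [co_T]
  refine Finset.sum_eq_zero fun k _ => Finset.sum_eq_zero fun I _ => ?_
  by_cases h : (B N).coord J (contr k (B N I)) = 0
  · rw [h, zero_smul]
  · obtain ⟨h1, rfl⟩ := contr_coord h
    rw [hx (insert k J) (by rw [Finset.card_insert_of_notMem h1]; omega)]
    simp

lemma contr_contr (k l : Fin N) (e : ExtN N) : contr k (contr l e) = - contr l (contr k e) :=
  CliffordAlgebra.contractLeft_comm _ _ _

lemma T_sq (u : Fin N → Rz N →ₗ[ℂ] Rz N) (hu : ∀ k l r, u k (u l r) = u l (u k r)) (x : PVz N) :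
    T u (T u x) = 0 := by
  induction x using TensorProduct.induction_on with
  | zero => simp
  | add x y hx hy => simp [hx, hy]
  | tmul r e =>
    rw [T_tmul, map_sum]
    simp only [T_tmul]
    set S := ∑ x, ∑ k, (u k) ((u x) r) ⊗ₜ[ℂ] (contr k) ((contr x) e) with hS
    have : S + S = 0 := by
      conv_lhs => enter [2]; rw [hS, Finset.sum_comm]
      rw [hS, ← Finset.sum_add_distrib]
      refine Finset.sum_eq_zero fun k _ => ?_
      rw [← Finset.sum_add_distrib]
      refine Finset.sum_eq_zero fun l _ => ?_
      rw [hu, ← TensorProduct.tmul_add, contr_contr, neg_add_cancel, TensorProduct.tmul_zero]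
    rw [← two_smul ℂ] at this
    exact (smul_eq_zero.mp this).resolve_left two_ne_zero

def Wd (c : Fin N → Rz N) : PVz N →ₗ[ℂ] PVz N :=
  ∑ i : Fin N, TensorProduct.map (LinearMap.mulLeft ℂ (c i)) (LinearMap.mulLeft ℂ (th i))

def K (g : Fin N → Rz N) : PVz N →ₗ[ℂ] PVz N := T fun k => LinearMap.mulLeft ℂ (g k)

lemma K_Wd (g c : Fin N → Rz N) (x : PVz N) :
    K g (Wd c x) + Wd c (K g x) = (∑ i, c i * g i) • x := by
  induction x using TensorProduct.induction_on with
  | zero => simp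
  | add x y hx hy =>
    simp only [map_add, smul_add]
    rw [← hx, ← hy]; abel
  | tmul r e =>
    simp only [K, T_tmul, Wd, LinearMap.sum_apply, map_sum, TensorProduct.map_tmul,
      LinearMap.mulLeft_apply]
    rw [Finset.sum_comm (f := fun x d => (c d * (g x * r)) ⊗ₜ[ℂ] (th d * contr x e)),
      ← Finset.sum_add_distrib, Finset.sum_smul]
    refine Finset.sum_congr rfl fun i _ => ?_
    rw [← Finset.sum_add_distrib, Finset.sum_eq_single i]
    · rw [show c i * (g i * r) = g i * (c i * r) by ring, ← TensorProduct.tmul_add, contr_th]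
      simp [TensorProduct.smul_tmul', mul_assoc, mul_left_comm]
    · intro k _ hk
      rw [show c i * (g k * r) = g k * (c i * r) by ring, ← TensorProduct.tmul_add, contr_th,
        if_neg hk]
      simp
    · simp

lemma Wd_gr (c : Fin N → Rz N) {p : ℕ} {x : PVz N} (hx : x ∈ PVzgr N p) :
    Wd c x ∈ PVzgr N (p+1) := by
  rw [mem_gr] at *
  intro J hJ
  simp only [Wd, LinearMap.sum_apply, map_sum, co_map]
  refine Finset.sum_eq_zero fun k _ => Finset.sum_eq_zero fun I _ => ?_
  by_cases h : I.card = p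
  · rw [coord_gr (p := p+1) _ hJ, zero_smul]
    subst h
    rw [grE, pow_succ']
    exact Submodule.mul_mem_mul ⟨_, rfl⟩ (B_mem I)
  · rw [hx I h]; simp

end TwistedAux

namespace TwistedAux
open Module
variable {N : ℕ}

def Q (N M j : ℕ) : Ideal (Rz N) :=
  Ideal.span ((fun s => monomial s (1 : Polynomial ℂ)) ''
    {s : Fin N →₀ ℕ | ∃ i : Fin N, i.val < j ∧ s = Finsupp.single i M})

lemma mem_Q {M j : ℕ} {x : Rz N} :
    x ∈ Q N M j ↔ ∀ m, x.coeff m ≠ 0 → ∃ i : Fin N, i.val < j ∧ M ≤ m i := by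
  rw [Q, mem_ideal_span_monomial_image]
  simp only [MvPolynomial.mem_support_iff, Set.mem_ofPred_eq]
  refine forall_congr' fun m => imp_congr_right fun _ => ?_
  constructor
  · rintro ⟨_, ⟨i, hi, rfl⟩, h⟩
    exact ⟨i, hi, by simpa using h⟩
  · rintro ⟨i, hi, h⟩
    exact ⟨_, ⟨i, hi, rfl⟩, by simpa using h⟩

lemma Q_zero {M : ℕ} {x : Rz N} (h : x ∈ Q N M 0) : x = 0 := by
  ext1 m
  by_contra hm
  obtain ⟨i, hi, _⟩ := mem_Q.1 h m hm
  omega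

lemma Q_cancel {M : ℕ} (i : Fin N) {x : Rz N} (h : X i ^ M * x ∈ Q N M i.val) :
    x ∈ Q N M i.val := by
  rw [mem_Q] at *
  intro m hm
  obtain ⟨l, hl, hM⟩ := h (Finsupp.single i M + m) (by
    rw [X_pow_eq_monomial, coeff_monomial_mul, one_mul]; exact hm)
  refine ⟨l, hl, ?_⟩
  have : i ≠ l := by rintro rfl; omega
  simpa [Finsupp.single_apply, this] using hM

def dv (s : Fin N →₀ ℕ) : Rz N →ₗ[ℂ] Rz N where
  toFun p := p.divMonomial s
  map_add' x y := add_divMonomial x y s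
  map_smul' c x := by ext1 m; simp [coeff_divMonomial]

lemma Q_split {M : ℕ} (i : Fin N) {x : Rz N} (h : x ∈ Q N M (i.val + 1)) :
    x - X i ^ M * dv (Finsupp.single i M) x ∈ Q N M i.val := by
  have h2 : x - X i ^ M * dv (Finsupp.single i M) x = x.modMonomial (Finsupp.single i M) := by
    rw [X_pow_eq_monomial, sub_eq_iff_eq_add']
    exact (divMonomial_add_modMonomial x _).symm
  rw [h2, mem_Q]
  intro m hm
  by_cases hs : Finsupp.single i M ≤ m
  · exact absurd (coeff_modMonomial_of_le _ hs) hm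
  · rw [coeff_modMonomial_of_not_le _ hs] at hm
    obtain ⟨l, hl, hM⟩ := mem_Q.1 h m hm
    refine ⟨l, ?_, hM⟩
    have : l ≠ i := by
      rintro rfl
      exact hs (by simpa using hM)
    have : l.val ≠ i.val := fun h => this (Fin.ext h)
    omega

def QK (N M j : ℕ) : AddSubgroup (PVz N) where
  carrier := {x | ∀ J, co J x ∈ Q N M j}
  zero_mem' := by intro J; simp
  add_mem' := by intro a b ha hb J; rw [map_add]; exact add_mem (ha J) (hb J)
  neg_mem' := by intro a ha J; rw [map_neg]; exact neg_mem (ha J)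

lemma QK_map {M j : ℕ} {x : PVz N} (hx : x ∈ QK N M j) (r : Rz N) (L : ExtN N →ₗ[ℂ] ExtN N) :
    TensorProduct.map (LinearMap.mulLeft ℂ r) L x ∈ QK N M j := by
  intro J
  rw [co_map]
  refine Submodule.sum_mem _ fun I _ => ?_
  rw [LinearMap.mulLeft_apply, ← mul_smul_comm, Algebra.smul_def, mul_left_comm]
  exact Ideal.mul_mem_left _ _ (Ideal.mul_mem_left _ _ (hx I))

lemma QK_K {M j : ℕ} {x : PVz N} (hx : x ∈ QK N M j) (g : Fin N → Rz N) :
    K g x ∈ QK N M j := by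
  rw [K, T, LinearMap.sum_apply]
  exact sum_mem fun k _ => QK_map hx _ _

lemma QK_Wd {M j : ℕ} {x : PVz N} (hx : x ∈ QK N M j) (g : Fin N → Rz N) :
    Wd g x ∈ QK N M j := by
  rw [Wd, LinearMap.sum_apply]
  exact sum_mem fun k _ => QK_map hx _ _

lemma K_sq (g : Fin N → Rz N) (x : PVz N) : K g (K g x) = 0 :=
  T_sq _ (by intro k l r; simp [mul_left_comm]) x

lemma K_smul (g : Fin N → Rz N) (r : Rz N) (x : PVz N) : K g (r • x) = r • K g x := by
  induction x using TensorProduct.induction_on with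
  | zero => simp
  | add x y hx hy => rw [smul_add, map_add, map_add, hx, hy, smul_add]
  | tmul r' e =>
    simp only [K, TensorProduct.smul_tmul', T_tmul, Finset.smul_sum, LinearMap.mulLeft_apply,
      smul_eq_mul, mul_left_comm]

lemma smul_gr {p : ℕ} {x : PVz N} (hx : x ∈ PVzgr N p) (r : Rz N) : r • x ∈ PVzgr N p := by
  rw [mem_gr] at *
  intro J hJ
  rw [co_smul, hx J hJ, mul_zero]

lemma gr_sub {p : ℕ} {x y : PVz N} (hx : x ∈ PVzgr N p) (hy : y ∈ PVzgr N p) :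
    x - y ∈ PVzgr N p := by
  rw [mem_gr] at *
  intro J hJ
  rw [map_sub, hx J hJ, hy J hJ, sub_zero]

lemma co_map_id (u : Rz N →ₗ[ℂ] Rz N) (J : Finset (Fin N)) (x : PVz N) :
    co J (TensorProduct.map u LinearMap.id x) = u (co J x) := by
  classical
  rw [co_map, Finset.sum_eq_single J]
  · simp
  · intro b _ hb; simp [hb]
  · simp

lemma koszul_step (g : Fin N → Rz N) (M : ℕ)
    (hM : ∀ i, ∃ c : Fin N → Rz N, X i ^ M = ∑ k, c k * g k) (t : ℕ) :
    ∀ j, j + t = N → ∀ p, j < p → ∀ a ∈ PVzgr N p, K g a ∈ QK N M j →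
      ∃ h ∈ PVzgr N (p+1), a - K g h ∈ QK N M j := by
  induction t with
  | zero =>
    intro j hj p hp a ha _
    have : a = 0 := co_ext fun J => by
      rw [mem_gr.1 ha J, map_zero]
      have := J.card_le_univ
      rw [Fintype.card_fin] at this
      omega
    refine ⟨0, Submodule.zero_mem _, ?_⟩
    rw [this, map_zero]
    exact sub_mem (zero_mem _) (zero_mem _)
  | succ t ih =>
    intro j hj p hp a ha hKa
    let i : Fin N := ⟨j, by omega⟩
    obtain ⟨c, hc⟩ := hM i
    have mono : ∀ x, x ∈ QK N M j → x ∈ QK N M (j+1) := by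
      intro x hx J
      have := hx J
      rw [mem_Q] at *
      intro m hm
      obtain ⟨l, hl, h⟩ := this m hm
      exact ⟨l, by omega, h⟩
    have e1 : K g (Wd c a) = (X i ^ M : Rz N) • a - Wd c (K g a) := by
      rw [hc, ← K_Wd]; abel
    have h1 : K g (Wd c a) ∈ QK N M (j+1) := by
      rw [e1]
      refine sub_mem ?_ (mono _ (QK_Wd hKa c))
      intro J
      rw [co_smul]
      refine Ideal.mul_mem_right _ _ (Ideal.subset_span ⟨Finsupp.single i M, ⟨i, by simp [i], rfl⟩, ?_⟩)
      simp [X_pow_eq_monomial]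
    obtain ⟨e, he, hQ⟩ := ih (j+1) (by omega) (p+1) (by omega) (Wd c a) (Wd_gr c ha) h1
    set x := Wd c a - K g e with hx
    have hxg : x ∈ PVzgr N (p+1) := gr_sub (Wd_gr c ha) (T_gr _ he)
    let h := TensorProduct.map (dv (Finsupp.single i M)) LinearMap.id x
    have hh : h ∈ PVzgr N (p+1) := by
      rw [mem_gr]
      intro J hJ
      rw [co_map_id, mem_gr.1 hxg J hJ, map_zero]
    have hr : x - (X i ^ M : Rz N) • h ∈ QK N M j := by
      intro J
      rw [map_sub, co_smul, co_map_id]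
      exact Q_split i (hQ J)
    refine ⟨h, hh, ?_⟩
    have h3 := QK_K hr g
    rw [map_sub, K_smul, hx, map_sub, K_sq, e1] at h3
    have h4 : (X i ^ M : Rz N) • (a - K g h) ∈ QK N M j := by
      have := add_mem h3 (QK_Wd hKa c)
      convert this using 1
      rw [smul_sub]; abel
    intro J
    have := h4 J
    rw [co_smul] at this
    exact Q_cancel i this

lemma koszul_exact (g : Fin N → Rz N) (M : ℕ)
    (hM : ∀ i, ∃ c : Fin N → Rz N, X i ^ M = ∑ k, c k * g k) (p : ℕ) (hp : 1 ≤ p)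
    (a : PVz N) (ha : a ∈ PVzgr N p) (h : K g a = 0) : ∃ h ∈ PVzgr N (p+1), K g h = a := by
  obtain ⟨b, hb, hQ⟩ := koszul_step g M hM N 0 (by omega) p hp a ha (by rw [h]; exact zero_mem _)
  refine ⟨b, hb, ?_⟩
  refine (co_ext fun J => ?_)
  have := Q_zero (hQ J)
  rw [map_sub, sub_eq_zero] at this
  exact this.symm

end TwistedAux

namespace TwistedAux
open Module
variable {N : ℕ}

def comp (w : Fin N → ℤ) (n : ℤ) : Rz N →ₗ[Polynomial ℂ] Rz N := weightedHomogeneousComponent w n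

lemma comp_hom {w : Fin N → ℤ} {n m : ℤ} {y : Rz N} (h : IsWeightedHomogeneous w y m) :
    comp w n y = if n = m then y else 0 := by
  rw [comp]
  exact weightedHomogeneousComponent_of_mem h

lemma comp_comp (w : Fin N → ℤ) (n m : ℤ) (y : Rz N) :
    comp w n (comp w m y) = if n = m then comp w m y else 0 :=
  comp_hom (weightedHomogeneousComponent_isWeightedHomogeneous m y)

lemma comp_mul {w : Fin N → ℤ} {e : ℤ} {g : Rz N} (hg : IsWeightedHomogeneous w g e) (m : ℤ)
    (y : Rz N) : comp w m (g * y) = g * comp w (m - e) y := by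
  induction y using MvPolynomial.induction_on' with
  | monomial s c =>
    have h := isWeightedHomogeneous_monomial w s c rfl
    rw [comp_hom h, comp_hom (hg.mul h), mul_ite, mul_zero]
    refine if_congr ?_ rfl rfl
    constructor <;> intro h <;> linarith
  | add p q hp hq => rw [mul_add, map_add, map_add, hp, hq, mul_add]

lemma comp_pderiv (w : Fin N → ℤ) (k : Fin N) (m : ℤ) (y : Rz N) :
    comp w m (pderiv k y) = pderiv k (comp w (m + w k) y) := by
  induction y using MvPolynomial.induction_on' with
  | monomial s c =>
    have h := isWeightedHomogeneous_monomial w s c rfl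
    rw [comp_hom h, comp_hom (h.pderiv (i := k) (n' := Finsupp.weight w s - w k) (by ring)),
      apply_ite (pderiv k), map_zero]
    refine if_congr ?_ rfl rfl
    constructor <;> intro h <;> linarith
  | add p q hp hq => rw [map_add, map_add, hp, hq, map_add, map_add]

lemma comp_neg {w : Fin N → ℤ} (hw : ∀ k, 0 < w k) {m : ℤ} (hm : m < 0) (y : Rz N) :
    comp w m y = 0 := by
  induction y using MvPolynomial.induction_on' with
  | monomial s c =>
    have h := isWeightedHomogeneous_monomial w s c rfl
    rw [comp_hom h, if_neg]
    have : 0 ≤ Finsupp.weight w s := by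
      rw [Finsupp.weight_apply]
      exact Finset.sum_nonneg fun i _ => nsmul_nonneg (hw i).le _
    omega
  | add p q hp hq => rw [map_add, hp, hq, add_zero]

lemma comp_large (w : Fin N → ℤ) (y : Rz N) : ∀ᶠ n in Filter.atTop, comp w n y = 0 := by
  induction y using MvPolynomial.induction_on' with
  | monomial s c =>
    have h := isWeightedHomogeneous_monomial w s c rfl
    filter_upwards [Filter.eventually_gt_atTop (Finsupp.weight w s)] with n hn
    rw [comp_hom h, if_neg (by omega)]
  | add p q hp hq =>
    filter_upwards [hp, hq] with n h1 h2
    rw [map_add, h1, h2, add_zero]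

lemma comp_all {w : Fin N → ℤ} {y : Rz N} (h : ∀ n, comp w n y = 0) : y = 0 := by
  ext1 s
  have := congrArg (coeff s) (h (Finsupp.weight w s))
  rw [comp, coeff_weightedHomogeneousComponent, if_pos rfl] at this
  exact this

def wt (u : Fin N → ℤ) (J : Finset (Fin N)) : ℤ := ∑ k ∈ J, u k

def pr (w u : Fin N → ℤ) (n : ℤ) (x : PVz N) : PVz N :=
  ∑ J, comp w (n - wt u J) (co J x) ⊗ₜ[ℂ] B N J

lemma co_pr (w u : Fin N → ℤ) (n : ℤ) (x : PVz N) (J : Finset (Fin N)) :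
    co J (pr w u n x) = comp w (n - wt u J) (co J x) := co_sum_tmul _ J

lemma pr_gr (w u : Fin N → ℤ) (n : ℤ) {p : ℕ} {x : PVz N} (hx : x ∈ PVzgr N p) :
    pr w u n x ∈ PVzgr N p := by
  rw [mem_gr] at *
  intro J hJ
  rw [co_pr, hx J hJ, map_zero]

lemma pr_sub (w u : Fin N → ℤ) (n : ℤ) (x y : PVz N) :
    pr w u n (x - y) = pr w u n x - pr w u n y := by
  refine co_ext fun J => ?_
  simp only [map_sub, co_pr]

lemma pr_add (w u : Fin N → ℤ) (n : ℤ) (x y : PVz N) :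
    pr w u n (x + y) = pr w u n x + pr w u n y := by
  refine co_ext fun J => ?_
  simp only [map_add, co_pr]

lemma pr_pr (w u : Fin N → ℤ) (n m : ℤ) (x : PVz N) :
    pr w u n (pr w u m x) = if n = m then pr w u m x else 0 := by
  refine co_ext fun J => ?_
  rw [co_pr, co_pr, comp_comp, apply_ite (co J), co_pr, map_zero]
  refine if_congr ?_ rfl rfl
  constructor <;> intro h <;> linarith

lemma pr_T {w u : Fin N → ℤ} {e : ℤ} {v : Fin N → Rz N →ₗ[ℂ] Rz N}
    (h : ∀ k m y, comp w m (v k y) = v k (comp w (m - u k + e) y)) (n : ℤ) (x : PVz N) :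
    pr w u n (T v x) = T v (pr w u (n + e) x) := by
  refine co_ext fun J => ?_
  rw [co_pr, co_T, co_T]
  simp only [map_sum]
  refine Finset.sum_congr rfl fun k _ => Finset.sum_congr rfl fun I _ => ?_
  by_cases h0 : (B N).coord J (contr k (B N I)) = 0
  · rw [h0, zero_smul, zero_smul, map_zero]
  · obtain ⟨h1, rfl⟩ := contr_coord h0
    rw [LinearMap.map_smul_of_tower, h, co_pr]
    congr 3
    rw [wt, wt, Finset.sum_insert h1]; ring_nf

lemma main_aux (w u : Fin N → ℤ) (d : ℤ) (hd : 0 < d) (hw : ∀ k, 0 < w k)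
    (D1 D2 : PVz N →ₗ[ℂ] PVz N) (p : ℕ)
    (h1 : ∀ n x, pr w u n (D1 x) = D1 (pr w u n x))
    (h2 : ∀ n x, pr w u n (D2 x) = D2 (pr w u (n + d) x))
    (g1 : ∀ x ∈ PVzgr N (p+1), D1 x ∈ PVzgr N p) (g2 : ∀ x ∈ PVzgr N (p+1), D2 x ∈ PVzgr N p)
    (hsq : ∀ x, D1 (D1 x + D2 x) + D2 (D1 x + D2 x) = 0)
    (hex : ∀ a ∈ PVzgr N p, D1 a = 0 → ∃ b ∈ PVzgr N (p+1), D1 b = a)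
    (a : PVz N) (ha : a ∈ PVzgr N p) (hD : D1 a + D2 a = 0) :
    ∃ b ∈ PVzgr N (p+1), D1 b + D2 b = a := by
  let C : ℤ := ∑ k, |u k|
  have hC : ∀ J, - C ≤ wt u J := by
    intro J
    have h3 : |wt u J| ≤ C := (Finset.abs_sum_le_sum_abs _ _).trans
      (Finset.sum_le_sum_of_subset_of_nonneg (Finset.subset_univ J) fun _ _ _ => abs_nonneg _)
    exact (abs_le.1 h3).1
  have key : ∀ t : ℕ, ∀ a ∈ PVzgr N p, D1 a + D2 a = 0 → (∀ n : ℤ, -C - 1 + t < n → pr w u n a = 0) →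
      ∃ b ∈ PVzgr N (p+1), D1 b + D2 b = a := by
    intro t
    induction t with
    | zero =>
      intro a ha hD h
      have : a = 0 := co_ext fun J => by
        rw [map_zero]
        apply comp_all (w := w)
        intro n
        by_cases hn : n < 0
        · exact comp_neg hw hn _
        · have h3 := congrArg (co J) (h (n + wt u J) (by have := hC J; push_cast; omega))
          rw [co_pr, map_zero] at h3
          simpa using h3
      exact ⟨0, Submodule.zero_mem _, by rw [map_zero, map_zero, this, add_zero]⟩
    | succ t ih =>
      intro a ha hD h
      set W : ℤ := -C + t with hW
      have e1 : D1 (pr w u W a) = 0 := by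
        have h3 : pr w u W (D1 a + D2 a) = 0 := by
          rw [hD]; exact co_ext fun J => by simp [co_pr]
        rw [pr_add, h1, h2, h (W + d) (by push_cast; omega), map_zero, add_zero] at h3
        exact h3
      obtain ⟨b', hb', hbe⟩ := hex _ (pr_gr w u W ha) e1
      set b := pr w u W b' with hb
      have hbg : b ∈ PVzgr N (p+1) := pr_gr w u W hb'
      have e2 : D1 b = pr w u W a := by
        rw [hb, ← h1, hbe, pr_pr, if_pos rfl]
      obtain ⟨b2, hb2, e3⟩ := ih (a - (D1 b + D2 b))
        (gr_sub ha (Submodule.add_mem _ (g1 b hbg) (g2 b hbg)))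
        (by
          rw [map_sub, map_sub]
          have h3 := hsq b
          calc _ = (D1 a + D2 a) - (D1 (D1 b + D2 b) + D2 (D1 b + D2 b)) := by abel
            _ = 0 := by rw [hD, h3]; exact co_ext fun J => by simp)
        (by
          intro n hn
          have hn' : W ≤ n := by omega
          rw [pr_sub, pr_add, h1, h2]
          have h4 : pr w u (n + d) b = 0 := by rw [hb, pr_pr, if_neg (by omega)]
          rw [h4, map_zero, add_zero]
          rcases hn'.eq_or_lt with h5 | h5
          · subst h5
            have h6 : pr w u W b = b := by rw [hb, pr_pr, if_pos rfl]
            rw [h6, e2]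
            exact co_ext fun J => by simp
          · have h6 : pr w u n b = 0 := by rw [hb, pr_pr, if_neg (by omega)]
            rw [h6, h n (by push_cast; omega), map_zero]
            exact co_ext fun J => by simp)
      refine ⟨b2 + b, Submodule.add_mem _ hb2 hbg, ?_⟩
      rw [map_add, map_add]
      calc _ = (D1 b2 + D2 b2) + (D1 b + D2 b) := by abel
        _ = a := by rw [e3]; abel
  have hbig : ∀ᶠ n : ℤ in Filter.atTop, ∀ J, comp w (n - wt u J) (co J a) = 0 := by
    rw [Filter.eventually_all]
    intro J
    exact (Filter.tendsto_atTop_add_const_right Filter.atTop (- wt u J) Filter.tendsto_id).eventually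
      (comp_large w (co J a))
  obtain ⟨W, hW⟩ := Filter.eventually_atTop.1 hbig
  refine key (W + C + 1).toNat a ha hD fun n hn => ?_
  refine co_ext fun J => ?_
  rw [co_pr, hW n (by have := Int.self_le_toNat (W + C + 1); omega), map_zero]

end TwistedAux

namespace TwistedAux
open Module
variable {N : ℕ}

lemma pderiv_comm' (k l : Fin N) (y : Rz N) : pderiv k (pderiv l y) = pderiv l (pderiv k y) := by
  have h : ⁅(pderiv k : Derivation (Polynomial ℂ) (Rz N) (Rz N)), (pderiv l : Derivation (Polynomial ℂ) (Rz N) (Rz N))⁆ = 0 := by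
    apply MvPolynomial.derivation_ext
    intro i
    rw [Derivation.commutator_apply, pderiv_X, pderiv_X, Pi.single_apply, Pi.single_apply]
    split_ifs <;> simp
  have := congrArg (fun D => D y) h
  rw [Derivation.commutator_apply] at this
  exact sub_eq_zero.1 this

lemma X_pow_mem {w : Fin N → ℤ} (hw : ∀ k, 0 < w k)
    {d : ℤ} {f : MvPolynomial (Fin N) ℂ} (hf : f.IsWeightedHomogeneous w d)
    (hiso : FiniteDimensional ℂ (MvPolynomial (Fin N) ℂ ⧸ jacobianIdeal f)) (i : Fin N) :
    ∃ n : ℕ, (X i : MvPolynomial (Fin N) ℂ) ^ n ∈ jacobianIdeal f := by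
  letI := MvPolynomial.weightedGradedAlgebra ℂ w
  have hJ : (jacobianIdeal f).IsHomogeneous (weightedHomogeneousSubmodule ℂ w) := by
    apply Ideal.homogeneous_span
    rintro _ ⟨k, rfl⟩
    exact ⟨d - w k, hf.pderiv (by ring)⟩
  obtain ⟨q, hq, hq0⟩ := Algebra.IsIntegral.isIntegral (R := ℂ)
    (Ideal.Quotient.mk (jacobianIdeal f) (X i))
  refine ⟨q.natDegree, ?_⟩
  have hmem : Polynomial.aeval (X i : MvPolynomial (Fin N) ℂ) q ∈ jacobianIdeal f := by
    rw [← Ideal.Quotient.eq_zero_iff_mem, ← hq0]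
    have := (Polynomial.aeval_algHom_apply (Ideal.Quotient.mkₐ ℂ (jacobianIdeal f)) (X i) q)
    exact this.symm
  have h2 := weightedHomogeneousComponent_mem_of_mem ℂ w hJ hmem (q.natDegree • w i)
  convert h2 using 1
  rw [Polynomial.aeval_eq_sum_range, map_sum, Finset.sum_eq_single q.natDegree]
  · rw [map_smul, hq.coeff_natDegree, one_smul]
    exact (((isWeightedHomogeneous_X ℂ w i).pow q.natDegree).weightedHomogeneousComponent_same).symm
  · intro n _ hn
    rw [map_smul, ((isWeightedHomogeneous_X ℂ w i).pow n).weightedHomogeneousComponent_ne,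
      smul_zero]
    intro h
    rw [nsmul_eq_mul, nsmul_eq_mul] at h
    have := mul_right_cancel₀ (hw i).ne' h
    exact hn (by exact_mod_cast this.symm)
  · simp

lemma exists_pow {w : Fin N → ℤ} (hw : ∀ k, 0 < w k)
    {d : ℤ} {f : MvPolynomial (Fin N) ℂ} (hf : f.IsWeightedHomogeneous w d)
    (hiso : FiniteDimensional ℂ (MvPolynomial (Fin N) ℂ ⧸ jacobianIdeal f)) :
    ∃ M : ℕ, ∀ i : Fin N, ∃ c : Fin N → Rz N,
      X i ^ M = ∑ k, c k * toRz (pderiv k f) := by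
  choose n hn using X_pow_mem hw hf hiso
  refine ⟨∑ i, n i, fun i => ?_⟩
  have h1 : (X i : MvPolynomial (Fin N) ℂ) ^ (∑ i, n i) ∈ jacobianIdeal f :=
    Ideal.mem_of_dvd _ (pow_dvd_pow _ (Finset.single_le_sum (fun _ _ => Nat.zero_le _)
      (Finset.mem_univ i))) (hn i)
  rw [jacobianIdeal, Ideal.mem_span_range_iff_exists_fun] at h1
  obtain ⟨c, hc⟩ := h1
  refine ⟨fun k => toRz (c k), ?_⟩
  have := congrArg (MvPolynomial.map (Polynomial.C : ℂ →+* Polynomial ℂ)) hc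
  rw [map_pow, map_X, map_sum] at this
  rw [← this]
  simp [toRz]

end TwistedAux

/-- If `f` defines a quasihomogeneous isolated singularity, then the complex
`(PV[z], D = ∂̄_f + z∂)` is exact in positive exterior degrees. -/
theorem twisted_complex_exact (N : ℕ) (hN : 0 < N) (w : Fin N → ℤ) (hw : ∀ k, 0 < w k)
    (d : ℤ) (hd : 0 < d) (f : MvPolynomial (Fin N) ℂ) (hf : f.IsWeightedHomogeneous w d)
    (hiso : FiniteDimensional ℂ (MvPolynomial (Fin N) ℂ ⧸ jacobianIdeal f)) :
    ∀ p : ℕ, 1 ≤ p → ∀ a ∈ PVzgr N p,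
      (Dop f a = 0 ↔ ∃ b ∈ PVzgr N (p + 1), Dop f b = a) := by
  intro p hp a ha
  let u : Fin N → ℤ := fun k => d - w k
  let g : Fin N → Rz N := fun k => toRz (pderiv k f)
  let v : Fin N → Rz N →ₗ[ℂ] Rz N := fun k => LinearMap.mulLeft ℂ (MvPolynomial.C Polynomial.X) ∘ₗ
        LinearMap.restrictScalars ℂ (pderiv k).toLinearMap
  have hv : ∀ k y, v k y = C Polynomial.X * pderiv k y := fun k y => rfl
  have hg : ∀ k, IsWeightedHomogeneous w (g k) (d - w k) := by
    intro k
    have h1 : (pderiv k f).IsWeightedHomogeneous w (d - w k) := hf.pderiv (by ring)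
    intro m hm
    apply h1
    intro h0
    apply hm
    simp [g, toRz, coeff_map, h0]
  have hDT : ∀ x, Dop f x = TwistedAux.T (fun k => LinearMap.mulLeft ℂ (g k) + v k) x :=
    fun x => rfl
  have hDop : ∀ x, Dop f x = TwistedAux.K g x + TwistedAux.T v x := fun x => by
    rw [hDT, TwistedAux.T_add]; rfl
  have hsq : ∀ x, Dop f (Dop f x) = 0 := by
    intro x
    rw [hDT, hDT]
    apply TwistedAux.T_sq
    intro k l r
    simp only [LinearMap.add_apply, LinearMap.mulLeft_apply, hv, map_add, Derivation.leibniz,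
      smul_eq_mul, pderiv_C]
    rw [TwistedAux.pderiv_comm' l k r]
    have : pderiv k (g l) = pderiv l (g k) := by
      simp only [g, toRz, ← pderiv_map]
      exact TwistedAux.pderiv_comm' _ _ _
    rw [this]
    ring
  constructor
  · intro h0
    obtain ⟨M, hM⟩ := TwistedAux.exists_pow hw hf hiso
    obtain ⟨b, hb, hbe⟩ := TwistedAux.main_aux w u d hd hw (TwistedAux.K g) (TwistedAux.T v) p
      (by
        intro n x
        have := TwistedAux.pr_T (w := w) (u := u) (e := 0)
          (v := fun k => LinearMap.mulLeft ℂ (g k)) (by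
            intro k m y
            rw [add_zero]
            exact TwistedAux.comp_mul (hg k) m y) n x
        rwa [add_zero] at this)
      (by
        intro n x
        refine TwistedAux.pr_T ?_ n x
        intro k m y
        rw [hv, hv, ← smul_eq_C_mul, ← smul_eq_C_mul, map_smul, TwistedAux.comp_pderiv]
        simp only [u]
        congr 4
        ring)
      (fun x hx => TwistedAux.T_gr _ hx) (fun x hx => TwistedAux.T_gr _ hx)
      (by intro x; rw [← hDop, ← hDop]; exact hsq x)
      (TwistedAux.koszul_exact g M hM p hp) a ha (by rw [← hDop]; exact h0)
    exact ⟨b, hb, by rw [hDop]; exact hbe⟩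
  · rintro ⟨b, _, rfl⟩
    exact hsq b
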